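/- Let $N \geq 2$, $1 \leq d < N$, $0 < p < q \leq \infty$ and $s > \sigma_p := N(1/p-1)_+$. Then there exists a function $f \in B^s_{p,q}(\mathbb{R}^N)$ such that $f(\cdot, y) \notin B^s_{p,\infty}(\mathbb{R}^d)$ for almost every $y \in \mathbb{R}^{N-d}$. -/

import Mathlib

open MeasureTheory
open scoped ENNReal

noncomputable section

/-- The `M`-th iterated difference operator `Δ_h^M f`. -/
def iterDiff {E : Type*} [AddCommGroup E] [Module ℝ E] (M : ℕ) (f : E → ℝ) (h : E) :
    E → ℝ :=
  fun x => ∑ i ∈ Finset.range (M + 1), (-1 : ℝ) ^ (M - i) * (M.choose i) * f (x + (i : ℝ) • h)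

/-- `σ_p = N (1/p - 1)_+`. -/
def sigmaP (n : ℕ) (p : ℝ≥0∞) : ℝ := n * max (1 / p.toReal - 1) 0

/-- The Besov quasi-norm on `ℝ^n`, defined via `M = ⌊s⌋ + 1` iterated differences:
`‖f‖_{L^p} + (∫_{|h|≤1} ‖Δ_h^M f‖_{L^p}^q |h|^{-n-sq} dh)^{1/q}`
(usual modification if `q = ∞`). -/
def besovNorm (n : ℕ) (p q : ℝ≥0∞) (s : ℝ) (f : (Fin n → ℝ) → ℝ) : ℝ≥0∞ :=
  eLpNorm f p volume +
    (if q = ⊤ then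
      ⨆ (h : Fin n → ℝ) (_ : ‖h‖ ≤ 1),
        eLpNorm (iterDiff (⌊s⌋₊ + 1) f h) p volume * ENNReal.ofReal (‖h‖ ^ (-s))
    else
      (∫⁻ h in {h : Fin n → ℝ | ‖h‖ ≤ 1},
          eLpNorm (iterDiff (⌊s⌋₊ + 1) f h) p volume ^ q.toReal *
            ENNReal.ofReal (‖h‖ ^ (-(n : ℝ) - s * q.toReal))) ^ (1 / q.toReal))

/-- Membership in the Besov space `B^s_{p,q}(ℝ^n)`. -/
def MemBesov (n : ℕ) (p q : ℝ≥0∞) (s : ℝ) (f : (Fin n → ℝ) → ℝ) : Prop :=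
  AEStronglyMeasurable f volume ∧ besovNorm n p q s f < ⊤

/-- The restriction `f(·, y)` of `f : ℝ^N → ℝ` to the `d`-plane with last `N - d`
coordinates equal to `y`. -/
def restrictLast (N d : ℕ) (f : (Fin N → ℝ) → ℝ) (y : Fin (N - d) → ℝ) :
    (Fin d → ℝ) → ℝ :=
  fun x => f fun i =>
    if h : (i : ℕ) < d then x ⟨i, h⟩ else y ⟨(i : ℕ) - d, by have := i.isLt; omega⟩

end

namespace BesovAux

lemma iterDiff_eq_fwdDiff {E : Type*} [AddCommGroup E] [Module ℝ E] (M : ℕ) (f : E → ℝ) (h x : E) :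
    iterDiff M f h x = (fwdDiff h)^[M] f x := by
  rw [fwdDiff_iter_eq_sum_shift]
  unfold iterDiff
  refine Finset.sum_congr rfl fun i _ => ?_
  rw [zsmul_eq_mul, Nat.cast_smul_eq_nsmul]
  push_cast
  ring

lemma iterDiff_succ {E : Type*} [AddCommGroup E] [Module ℝ E] (M : ℕ) (f : E → ℝ) (h x : E) :
    iterDiff (M + 1) f h x = iterDiff M ((fun z => f (z + h)) - f) h x := by
  rw [iterDiff_eq_fwdDiff, iterDiff_eq_fwdDiff, Function.iterate_succ_apply]
  rfl

lemma abs_iterDiff_le_deriv {E : Type*} [NormedAddCommGroup E] [NormedSpace ℝ E] (M : ℕ) :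
    ∀ (f : E → ℝ) (C : ℝ), ContDiff ℝ M f → (∀ x, ‖iteratedFDeriv ℝ M f x‖ ≤ C) →
      ∀ h x, |iterDiff M f h x| ≤ C * ‖h‖ ^ M := by
  induction M with
  | zero =>
    intro f C hf hC h x
    have := hC x
    simpa [iterDiff] using this
  | succ M ih =>
    intro f C hf hC h x
    rw [iterDiff_succ]
    have hf' : ContDiff ℝ M f := hf.of_le (by exact_mod_cast Nat.le_succ M)
    have hg' : ContDiff ℝ M (fun z => f (z + h)) := hf'.comp (contDiff_id.add contDiff_const)
    have := ih ((fun z => f (z + h)) - f) (C * ‖h‖) (hg'.sub hf') ?_ h x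
    · calc _ ≤ _ := this
        _ = _ := by ring
    · intro z
      rw [iteratedFDeriv_sub_apply hg'.contDiffAt hf'.contDiffAt, iteratedFDeriv_comp_add_right]
      have hd : Differentiable ℝ (iteratedFDeriv ℝ M f) :=
        hf.differentiable_iteratedFDeriv (by exact_mod_cast Nat.lt_succ_self M)
      have := Convex.norm_image_sub_le_of_norm_fderiv_le (𝕜 := ℝ) (f := iteratedFDeriv ℝ M f)
        (C := C) (s := Set.univ) (x := z) (y := z + h) (fun x _ => hd x)
        (fun x _ => by rw [norm_fderiv_iteratedFDeriv]; exact hC x) convex_univ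
        (Set.mem_univ _) (Set.mem_univ _)
      simpa using this

lemma abs_iterDiff_le_sup {E : Type*} [AddCommGroup E] [Module ℝ E] (M : ℕ) :
    ∀ (f : E → ℝ) (C : ℝ), (∀ x, |f x| ≤ C) → ∀ h x, |iterDiff M f h x| ≤ 2 ^ M * C := by
  induction M with
  | zero =>
    intro f C hC h x
    have := hC x
    simpa [iterDiff] using this
  | succ M ih =>
    intro f C hC h x
    rw [iterDiff_succ]
    have := ih ((fun z => f (z + h)) - f) (2 * C) ?_ h x
    · calc _ ≤ _ := this
        _ = _ := by ring
    · intro z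
      have h1 := hC (z + h)
      have h2 := hC z
      simp only [Pi.sub_apply]
      have := abs_sub (f (z + h)) (f z)
      linarith

/-- A bump function equal to 1 on the unit cube, supported in the cube of radius 2. -/
lemma exists_bump (N M : ℕ) : ∃ (Φ : (Fin N → ℝ) → ℝ) (C : ℝ), Continuous Φ ∧ 0 < C ∧
    (∀ x, 0 ≤ Φ x) ∧ (∀ x, Φ x ≤ 1) ∧ (∀ x, ‖x‖ ≤ 1 → Φ x = 1) ∧ (∀ x, Φ x ≠ 0 → ‖x‖ < 2) ∧
    ∀ h x, |iterDiff M Φ h x| ≤ C * min 1 ‖h‖ ^ M := by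
  let Φ : ContDiffBump (0 : Fin N → ℝ) := ⟨1, 2, by norm_num, by norm_num⟩
  have hc : ContDiff ℝ M (Φ : (Fin N → ℝ) → ℝ) := Φ.contDiff (n := (M : ℕ∞))
  obtain ⟨C, hC⟩ := (Φ.hasCompactSupport.iteratedFDeriv (𝕜 := ℝ) M).exists_bound_of_continuous
    (hc.continuous_iteratedFDeriv le_rfl)
  have hC0 : 0 ≤ C := (norm_nonneg _).trans (hC 0)
  refine ⟨Φ, C + 2 ^ M, Φ.continuous, by positivity, fun x => Φ.nonneg, fun x => Φ.le_one, ?_, ?_, ?_⟩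
  · intro x hx
    exact Φ.one_of_mem_closedBall (by simpa [Φ] using hx)
  · intro x hx
    have : x ∈ Function.support Φ := hx
    rw [Φ.support_eq] at this
    simpa [Φ] using this
  · intro h x
    have h1 := abs_iterDiff_le_deriv M Φ C hc hC h x
    have h2 := abs_iterDiff_le_sup M Φ 1 (fun x => by
      rw [abs_of_nonneg Φ.nonneg]; exact Φ.le_one) h x
    rcases le_total ‖h‖ 1 with hh | hh
    · rw [min_eq_right hh]
      have : 0 ≤ (2:ℝ) ^ M * ‖h‖ ^ M := by positivity
      linarith
    · rw [min_eq_left hh]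
      simp only [one_pow, mul_one] at *
      linarith

/-- Two-sided geometric series. -/
lemma tsum_int_geom_lt_top (u : ℝ≥0∞) (hu : u < 1) : ∑' m : ℤ, u ^ m.natAbs < ⊤ := by
  rw [tsum_of_nat_of_neg_add_one ENNReal.summable ENNReal.summable]
  have h1 : ∑' n : ℕ, u ^ n < ⊤ := by
    rw [ENNReal.tsum_geometric]
    simpa using hu
  refine ENNReal.add_lt_top.2 ⟨by simpa using h1, ?_⟩
  refine lt_of_le_of_lt (ENNReal.tsum_le_tsum fun n => ?_) h1
  have : (-((n : ℤ) + 1)).natAbs = n + 1 := by omega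
  rw [this, pow_succ]
  exact mul_le_of_le_one_right' hu.le

lemma discrete_young {ι : Type*} (j : ι → ℕ) (hj : Function.Injective j) (c : ι → ℝ≥0∞)
    (u : ℝ≥0∞) (hu : u < 1) (r : ℝ) (hr : 1 < r) (hc : ∑' i, c i ^ r < ⊤) (S : ℕ → ℝ≥0∞)
    (hS : ∀ J : ℕ, S J = ∑' i, c i * (u ^ ((j i : ℤ) - J).natAbs * u ^ ((j i : ℤ) - J).natAbs)) :
    (∃ B < ⊤, ∀ J, S J ≤ B) ∧ ∑' J, S J ^ r < ⊤ := by
  have hr0 : 0 < r := by linarith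
  set U := ∑' m : ℤ, u ^ m.natAbs with hU
  have hUt : U < ⊤ := tsum_int_geom_lt_top u hu
  have key : ∀ J, S J ^ r ≤ U ^ r * ∑' i, c i ^ r * u ^ ((j i : ℤ) - J).natAbs := by
    intro J
    have h1 : S J ≤ U * (∑' i, c i ^ r * u ^ ((j i : ℤ) - J).natAbs) ^ (1 / r) := by
      have h2 : ∀ i, c i * u ^ ((j i : ℤ) - J).natAbs ≤
          (∑' i, c i ^ r * u ^ ((j i : ℤ) - J).natAbs) ^ (1 / r) := by
        intro i
        rw [one_div, ENNReal.le_rpow_inv_iff hr0, ENNReal.mul_rpow_of_nonneg _ _ hr0.le]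
        refine le_trans ?_ (ENNReal.le_tsum i)
        gcongr
        exact ENNReal.rpow_le_self_of_le_one (pow_le_one' hu.le _) hr.le
      rw [hS]
      calc _ ≤ ∑' i, u ^ ((j i : ℤ) - J).natAbs *
            (∑' i, c i ^ r * u ^ ((j i : ℤ) - J).natAbs) ^ (1 / r) := by
            refine ENNReal.tsum_le_tsum fun i => ?_
            rw [← mul_assoc, mul_comm]
            gcongr
            exact h2 i
        _ ≤ _ := by
            rw [ENNReal.tsum_mul_right]
            gcongr
            have hinj : Function.Injective (fun i => (j i : ℤ) - J) := by
              intro a b hab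
              apply hj
              simpa using hab
            exact ENNReal.tsum_comp_le_tsum_of_injective hinj (fun m : ℤ => u ^ m.natAbs)
    calc S J ^ r ≤ _ := ENNReal.rpow_le_rpow h1 hr0.le
      _ = _ := by
        rw [ENNReal.mul_rpow_of_nonneg _ _ hr0.le, ← ENNReal.rpow_mul, one_div_mul_cancel hr0.ne',
          ENNReal.rpow_one]
  constructor
  · refine ⟨(U ^ r * ∑' i, c i ^ r) ^ (1 / r), ?_, fun J => ?_⟩
    · apply ENNReal.rpow_lt_top_of_nonneg (by positivity)
      exact (ENNReal.mul_lt_top (ENNReal.rpow_lt_top_of_nonneg hr0.le hUt.ne) hc).ne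
    · rw [one_div, ENNReal.le_rpow_inv_iff hr0]
      refine (key J).trans ?_
      gcongr
      exact mul_le_of_le_one_right' (pow_le_one' hu.le _)
  · calc _ ≤ ∑' J : ℕ, U ^ r * ∑' i, c i ^ r * u ^ ((j i : ℤ) - J).natAbs :=
          ENNReal.tsum_le_tsum key
      _ = U ^ r * ∑' i, c i ^ r * ∑' J : ℕ, u ^ ((j i : ℤ) - J).natAbs := by
          rw [ENNReal.tsum_mul_left, ENNReal.tsum_comm]
          simp_rw [ENNReal.tsum_mul_left]
      _ ≤ U ^ r * ∑' i, c i ^ r * U := by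
          gcongr with i
          have hinj : Function.Injective (fun J : ℕ => (j i : ℤ) - J) := by
            intro a b hab
            simpa using hab
          exact ENNReal.tsum_comp_le_tsum_of_injective hinj (fun m : ℤ => u ^ m.natAbs)
      _ < ⊤ := by
          rw [ENNReal.tsum_mul_right]
          exact ENNReal.mul_lt_top (ENNReal.rpow_lt_top_of_nonneg hr0.le hUt.ne)
            (ENNReal.mul_lt_top hc hUt)

/-- Integration over dyadic shells. -/
lemma shell_integral (N : ℕ) (hN : 1 ≤ N) (G : (Fin N → ℝ) → ℝ≥0∞) (A : ℕ → ℝ≥0∞)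
    (hG : ∀ J : ℕ, ∀ h : Fin N → ℝ, (1 / 2 : ℝ) ^ (J + 1) < ‖h‖ → ‖h‖ ≤ (1 / 2) ^ J →
      G h ≤ A J * ENNReal.ofReal (‖h‖ ^ (-(N : ℝ)))) :
    ∫⁻ h in {h : Fin N → ℝ | ‖h‖ ≤ 1}, G h ≤ 4 ^ N * ∑' J, A J := by
  set sh : ℕ → Set (Fin N → ℝ) := fun J => {h | (1 / 2 : ℝ) ^ (J + 1) < ‖h‖ ∧ ‖h‖ ≤ (1 / 2) ^ J} with hsh
  have hsub : {h : Fin N → ℝ | ‖h‖ ≤ 1} ⊆ {0} ∪ ⋃ J, sh J := by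
    intro h hh
    by_cases h0 : h = 0
    · left; exact h0
    · right
      obtain ⟨J, h1, h2⟩ := exists_nat_pow_near_of_lt_one (norm_pos_iff.2 h0) hh
        (by norm_num : (0:ℝ) < 1 / 2) (by norm_num)
      exact Set.mem_iUnion.2 ⟨J, h1, h2⟩
  have hms : ∀ J, MeasurableSet (sh J) := fun J =>
    (measurableSet_lt measurable_const measurable_norm).inter
      (measurableSet_le measurable_norm measurable_const)
  have : Nonempty (Fin N) := ⟨⟨0, hN⟩⟩
  have hz : volume ({0} : Set (Fin N → ℝ)) = 0 := measure_singleton _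
  calc _ ≤ ∫⁻ h in {0} ∪ ⋃ J, sh J, G h := lintegral_mono_set hsub
    _ ≤ (∫⁻ h in {0}, G h) + ∫⁻ h in ⋃ J, sh J, G h := lintegral_union_le _ _ _
    _ = ∫⁻ h in ⋃ J, sh J, G h := by rw [setLIntegral_measure_zero _ _ hz, zero_add]
    _ ≤ ∑' J, ∫⁻ h in sh J, G h := lintegral_iUnion_le _ _
    _ ≤ ∑' J, 4 ^ N * A J := by
      refine ENNReal.tsum_le_tsum fun J => ?_
      have hpos : (0:ℝ) < (1 / 2) ^ (J + 1) := by positivity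
      calc _ ≤ ∫⁻ h in sh J, A J * ENNReal.ofReal (((1 / 2 : ℝ) ^ (J + 1)) ^ (-(N : ℝ))) := by
            refine setLIntegral_mono' (hms J) fun h hh => (hG J h hh.1 hh.2).trans ?_
            exact mul_le_mul' le_rfl (ENNReal.ofReal_le_ofReal
              (Real.rpow_le_rpow_of_nonpos hpos hh.1.le (neg_nonpos.2 (Nat.cast_nonneg N))))
        _ = A J * ENNReal.ofReal (((1 / 2 : ℝ) ^ (J + 1)) ^ (-(N : ℝ))) * volume (sh J) := by
            rw [setLIntegral_const]
        _ ≤ A J * ENNReal.ofReal (((1 / 2 : ℝ) ^ (J + 1)) ^ (-(N : ℝ))) *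
              ENNReal.ofReal ((2 * (1 / 2) ^ J) ^ N) := by
            gcongr
            have : sh J ⊆ Metric.closedBall 0 ((1 / 2) ^ J) := fun h hh => by simpa using hh.2
            refine (measure_mono this).trans ?_
            rw [Real.volume_pi_closedBall _ (by positivity)]
            simp
        _ = 4 ^ N * A J := by
            rw [mul_assoc, ← ENNReal.ofReal_mul (by positivity), mul_comm]
            congr 1
            rw [Real.rpow_neg hpos.le, Real.rpow_natCast, ← inv_pow, ← mul_pow]
            have : ((1 / 2 : ℝ) ^ (J + 1))⁻¹ * (2 * (1 / 2) ^ J) = 4 := by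
              rw [pow_succ]
              have : (1 / 2 : ℝ) ^ J ≠ 0 := by positivity
              field_simp
              norm_num
            rw [this, ENNReal.ofReal_pow (by norm_num)]
            norm_num
    _ = _ := ENNReal.tsum_mul_left

/-- The scalar kernel bound. -/
lemma kernel_bound (α β : ℝ) (hα : 0 < α) (hαβ : α < β) : ∃ u K : ℝ, 0 < u ∧ u < 1 ∧ 0 < K ∧
    ∀ (j J : ℕ) (t : ℝ), (1 / 2 : ℝ) ^ (J + 1) < t → t ≤ (1 / 2) ^ J →
      (2 ^ j * t : ℝ) ^ (-α) * (min 1 (2 ^ j * t)) ^ β ≤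
        K * (u ^ ((j : ℤ) - J).natAbs * u ^ ((j : ℤ) - J).natAbs) := by
  set γ := min α (β - α) with hγ
  have hγ0 : 0 < γ := lt_min hα (by linarith)
  refine ⟨2 ^ (-γ / 2), 2 ^ α, by positivity,
    Real.rpow_lt_one_of_one_lt_of_neg (by norm_num) (by linarith), by positivity, ?_⟩
  intro j J t h1 h2
  have ht : 0 < t := lt_trans (by positivity) h1
  have hu : ∀ m : ℕ, ((2:ℝ) ^ (-γ / 2)) ^ m * ((2:ℝ) ^ (-γ / 2)) ^ m = 2 ^ (-γ * m) := by
    intro m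
    rw [← mul_pow, ← Real.rpow_add (by norm_num), ← Real.rpow_mul_natCast (by norm_num)]
    congr 1; ring
  rw [hu]
  have hv : (0:ℝ) < 2 ^ j * t := by positivity
  rcases le_or_gt j J with hjJ | hjJ
  · obtain ⟨m, rfl⟩ := Nat.exists_eq_add_of_le hjJ
    have hm : ((j : ℤ) - (j + m : ℕ)).natAbs = m := by omega
    rw [hm]
    have hv1 : (2 ^ j * t : ℝ) ≤ 2 ^ (-(m:ℝ)) := by
      calc (2 ^ j * t : ℝ) ≤ 2 ^ j * (1 / 2) ^ (j + m) := by gcongr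
        _ = 2 ^ (-(m:ℝ)) := by
          rw [Real.rpow_neg (by norm_num), Real.rpow_natCast, pow_add, one_div, inv_pow, inv_pow]
          field_simp
    have hv2 : (2:ℝ) ^ (-(m:ℝ)) ≤ 1 := Real.rpow_le_one_of_one_le_of_nonpos (by norm_num) (by simp)
    rw [min_eq_right (hv1.trans hv2), ← Real.rpow_add hv]
    calc (2 ^ j * t : ℝ) ^ (-α + β) ≤ (2 ^ (-(m:ℝ)) : ℝ) ^ (-α + β) :=
          Real.rpow_le_rpow hv.le hv1 (by linarith)
      _ = 2 ^ (-(m:ℝ) * (-α + β)) := by rw [← Real.rpow_mul (by norm_num)]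
      _ ≤ 2 ^ (-γ * m) := by
          apply Real.rpow_le_rpow_of_exponent_le (by norm_num)
          have : γ ≤ β - α := min_le_right _ _
          nlinarith [(Nat.cast_nonneg m : (0:ℝ) ≤ m)]
      _ ≤ 2 ^ α * 2 ^ (-γ * m) := by
          have : (1:ℝ) ≤ 2 ^ α := Real.one_le_rpow (by norm_num) hα.le
          have h0 : (0:ℝ) < 2 ^ (-γ * m) := by positivity
          nlinarith
  · obtain ⟨m, rfl⟩ := Nat.exists_eq_add_of_lt hjJ
    have hm : (((J + m + 1 : ℕ) : ℤ) - J).natAbs = m + 1 := by omega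
    rw [hm]
    have hv1 : (2:ℝ) ^ (m:ℝ) ≤ 2 ^ (J + m + 1) * t := by
      calc (2:ℝ) ^ (m:ℝ) = 2 ^ (J + m + 1) * (1 / 2) ^ (J + 1) := by
            rw [Real.rpow_natCast, one_div, inv_pow]
            field_simp
            ring
        _ ≤ _ := by gcongr
    have hmin : (min 1 (2 ^ (J + m + 1) * t) : ℝ) ^ β ≤ 1 :=
      Real.rpow_le_one (le_min zero_le_one hv.le) (min_le_left _ _) (by linarith)
    calc _ ≤ (2 ^ (J + m + 1) * t : ℝ) ^ (-α) * 1 := by gcongr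
      _ ≤ (2 ^ (m:ℝ) : ℝ) ^ (-α) := by
          rw [mul_one]
          exact Real.rpow_le_rpow_of_nonpos (by positivity) hv1 (by linarith)
      _ = 2 ^ α * 2 ^ (-α * ((m + 1 : ℕ) : ℝ)) := by
          rw [← Real.rpow_mul (by norm_num), ← Real.rpow_add (by norm_num)]
          congr 1; push_cast; ring
      _ ≤ _ := by
          gcongr
          · norm_num
          · exact min_le_left _ _

/-- Choice of the parameters: small cubes covering everything infinitely often. -/
lemma exists_params (n : ℕ) (hn : 1 ≤ n) (P r : ℝ) (hr : 1 < r) :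
    ∃ (ι : Type) (j : ι → ℕ) (a k : ι → ℝ) (y : ι → Fin n → ℝ), Function.Injective j ∧
      (∀ i, 0 < a i) ∧ (∀ i, 1 ≤ k i) ∧ (∀ i, k i ≤ 2 ^ j i) ∧ (∀ i, (4 : ℝ) ≤ 2 ^ j i) ∧
      (∑' i, ENNReal.ofReal (a i ^ P * (k i)⁻¹ ^ n) ^ r < ⊤) ∧
      ∀ (w : Fin n → ℝ) (L : ℝ), ∃ i, L ≤ a i ∧ ∀ m, |k i * (w m - y i m)| ≤ 1 := by
  have hK : ∀ L : ℕ, ∃ K : ℕ, 1 ≤ K ∧ ((2 * (L + 1) * K + 1 : ℕ) : ℝ) ^ n *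
      (((L + 1 : ℕ) : ℝ) ^ P * (K : ℝ)⁻¹ ^ n) ^ r ≤ (1 / 2) ^ L := by
    intro L
    have hlim : Filter.Tendsto (fun K : ℕ => ((3 * (L + 1 : ℝ)) ^ n * (((L + 1 : ℕ) : ℝ) ^ P) ^ r) *
        (K : ℝ) ^ (-(n * (r - 1)))) Filter.atTop (nhds 0) := by
      have h1 := (tendsto_rpow_neg_atTop (y := n * (r - 1)) (by
        have : (0:ℝ) < n := by exact_mod_cast hn
        have : 0 < r - 1 := by linarith
        positivity)).comp (tendsto_natCast_atTop_atTop (R := ℝ))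
      simpa using h1.const_mul ((3 * (L + 1 : ℝ)) ^ n * (((L + 1 : ℕ) : ℝ) ^ P) ^ r)
    have hev := hlim.eventually (gt_mem_nhds (show (0:ℝ) < (1 / 2) ^ L by positivity))
    obtain ⟨K, hK1, hK2⟩ := (hev.and (Filter.eventually_ge_atTop 1)).exists
    refine ⟨K, hK2, le_trans ?_ hK1.le⟩
    have hKp : (0:ℝ) < K := by exact_mod_cast hK2
    have hK1' : (1:ℝ) ≤ K := by exact_mod_cast hK2
    have e1 : (((L + 1 : ℕ) : ℝ) ^ P * (K : ℝ)⁻¹ ^ n) ^ r =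
        (((L + 1 : ℕ) : ℝ) ^ P) ^ r * (K:ℝ) ^ (-(n * r)) := by
      rw [Real.mul_rpow (by positivity) (by positivity)]
      congr 1
      rw [← Real.rpow_natCast, ← Real.rpow_mul (by positivity), Real.inv_rpow hKp.le,
        Real.rpow_neg hKp.le]
    have e2 : (K:ℝ) ^ (-(n * (r - 1))) = (K:ℝ) ^ n * (K:ℝ) ^ (-(n * r)) := by
      rw [← Real.rpow_natCast, ← Real.rpow_add hKp]
      congr 1; ring
    rw [e1, e2]
    have e3 : ((2 * (L + 1) * K + 1 : ℕ) : ℝ) ^ n ≤ (3 * (L + 1 : ℝ)) ^ n * (K:ℝ) ^ n := by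
      rw [← mul_pow]
      gcongr
      push_cast
      have : (0:ℝ) ≤ L := Nat.cast_nonneg L
      nlinarith
    calc _ ≤ (3 * (L + 1 : ℝ)) ^ n * (K:ℝ) ^ n *
          ((((L + 1 : ℕ) : ℝ) ^ P) ^ r * (K:ℝ) ^ (-(n * r))) := by gcongr
      _ = _ := by ring
  choose K hK1 hK2 using hK
  let ι : Type := Σ L : ℕ, (Fin n → Fin (2 * (L + 1) * K L + 1))
  obtain ⟨e, he⟩ := exists_injective_nat ι
  have hpw : ∀ m : ℕ, (m : ℝ) ≤ 2 ^ m := fun m => by exact_mod_cast Nat.lt_two_pow_self.le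
  refine ⟨ι, fun i => Nat.pair (e i) (K i.1 + 2), fun i => ((i.1 + 1 : ℕ) : ℝ),
    fun i => (K i.1 : ℝ), fun i m => ((i.2 m : ℕ) : ℝ) / K i.1 - ((i.1 + 1 : ℕ) : ℝ),
    ?_, ?_, ?_, ?_, ?_, ?_, ?_⟩
  · intro a b hab
    exact he (Nat.pair_eq_pair.1 hab).1
  · intro i; positivity
  · intro i
    show (1:ℝ) ≤ (K i.1 : ℝ)
    exact_mod_cast hK1 i.1
  · intro i
    refine (hpw _).trans (pow_le_pow_right₀ (by norm_num) ?_)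
    exact le_trans (by omega) (Nat.right_le_pair _ _)
  · intro i
    calc (4:ℝ) = 2 ^ 2 := by norm_num
      _ ≤ _ := pow_le_pow_right₀ (by norm_num) (le_trans (by omega) (Nat.right_le_pair _ _))
  · rw [ENNReal.tsum_sigma']
    calc _ ≤ ∑' L : ℕ, (ENNReal.ofReal (1 / 2)) ^ L := by
          refine ENNReal.tsum_le_tsum fun L => ?_
          rw [tsum_fintype]
          simp only [Finset.sum_const, Finset.card_univ, Fintype.card_pi, Fintype.card_fin,
            Finset.prod_const, nsmul_eq_mul]
          rw [← ENNReal.ofReal_pow (by norm_num), ENNReal.ofReal_rpow_of_nonneg (by positivity) (by linarith)]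
          refine le_trans (le_of_eq ?_) (ENNReal.ofReal_le_ofReal (hK2 L))
          rw [ENNReal.ofReal_mul (by positivity), ← Nat.cast_pow, ENNReal.ofReal_natCast]
      _ < ⊤ := by
          rw [ENNReal.tsum_geometric]
          simp
  · intro w L
    obtain ⟨T, hT⟩ := exists_nat_ge (max L ‖w‖)
    have hKp : (0:ℝ) < K T := by exact_mod_cast hK1 T
    have hw : ∀ m, |w m| ≤ T := fun m =>
      (norm_le_pi_norm w m).trans ((le_max_right _ _).trans hT)
    have hnn : ∀ m, 0 ≤ (w m + (T + 1)) * K T := fun m => by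
      have := abs_le.1 (hw m)
      exact mul_nonneg (by linarith) hKp.le
    have hlt : ∀ m, ⌊(w m + (T + 1)) * K T⌋₊ < 2 * (T + 1) * K T + 1 := by
      intro m
      rw [Nat.floor_lt (hnn m)]
      push_cast
      have := abs_le.1 (hw m)
      nlinarith
    refine ⟨⟨T, fun m => ⟨_, hlt m⟩⟩, ?_, ?_⟩
    · push_cast
      linarith [(le_max_left _ _).trans hT]
    · intro m
      simp only
      have h1 := Nat.floor_le (hnn m)
      have h2 := Nat.lt_floor_add_one ((w m + (T + 1)) * K T)
      have : (K T : ℝ) * (w m - ((⌊(w m + (T + 1)) * K T⌋₊ : ℝ) / K T - ((T + 1 : ℕ) : ℝ))) =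
          (w m + (T + 1)) * K T - (⌊(w m + (T + 1)) * K T⌋₊ : ℝ) := by
        push_cast
        field_simp
        ring
      rw [this, abs_le]
      constructor <;> linarith

/-- Rough `L^p` bound by height and the measure of the support. -/
lemma lintegral_le_of_support {N : ℕ} (M : ℕ) (g : (Fin N → ℝ) → ℝ) (B : Set (Fin N → ℝ))
    (hB : MeasurableSet B) (h : Fin N → ℝ) (D P : ℝ) (hP : 0 < P) (hD : ∀ x, |g x| ≤ D)
    (hg : ∀ x, g x ≠ 0 → ∃ i ∈ Finset.range (M + 1), x + (i : ℝ) • h ∈ B) :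
    ∫⁻ x, ‖g x‖ₑ ^ P ≤ (M + 1 : ℕ) * volume B * ENNReal.ofReal (D ^ P) := by
  set U : Set (Fin N → ℝ) := ⋃ i ∈ Finset.range (M + 1), (fun x => x + (i : ℝ) • h) ⁻¹' B with hU
  have hD0 : 0 ≤ D := (abs_nonneg _).trans (hD 0)
  have hUm : MeasurableSet U := Finset.measurableSet_biUnion _ fun i _ =>
    (measurable_id.add_const _) hB
  calc ∫⁻ x, ‖g x‖ₑ ^ P ≤ ∫⁻ x, U.indicator (fun _ => ENNReal.ofReal (D ^ P)) x := by
        refine lintegral_mono fun x => ?_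
        by_cases hx : g x = 0
        · simp [hx, hP]
        · have hxU : x ∈ U := by
            obtain ⟨i, hi, hiB⟩ := hg x hx
            exact Set.mem_biUnion hi hiB
          rw [Set.indicator_of_mem hxU, ← ENNReal.ofReal_rpow_of_nonneg hD0 hP.le,
            Real.enorm_eq_ofReal_abs]
          exact ENNReal.rpow_le_rpow (ENNReal.ofReal_le_ofReal (hD x)) hP.le
    _ = ENNReal.ofReal (D ^ P) * volume U := by
        rw [lintegral_indicator hUm, setLIntegral_const]
    _ ≤ ENNReal.ofReal (D ^ P) * ((M + 1 : ℕ) * volume B) := by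
        gcongr
        refine (measure_biUnion_finset_le _ _).trans ?_
        simp [measure_preimage_add_right]
    _ = _ := by ring

lemma iterDiff_affine {N : ℕ} (M : ℕ) (Φ : (Fin N → ℝ) → ℝ) (A : ℝ) (t c h x : Fin N → ℝ) :
    iterDiff M (fun x => A * Φ (fun m => t m * (x m - c m))) h x =
      A * iterDiff M Φ (fun m => t m * h m) (fun m => t m * (x m - c m)) := by
  unfold iterDiff
  rw [Finset.mul_sum]
  refine Finset.sum_congr rfl fun i _ => ?_
  have : (fun m => t m * ((x + (i : ℝ) • h) m - c m)) =
      (fun m => t m * (x m - c m)) + (i : ℝ) • (fun m => t m * h m) := by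
    funext m
    simp
    ring
  simp only [this]
  ring

noncomputable def scal (N d : ℕ) (lam k : ℝ) : Fin N → ℝ := fun m => if (m : ℕ) < d then lam else k

noncomputable def ctr (N d : ℕ) (x0 : ℝ) (y : Fin (N - d) → ℝ) : Fin N → ℝ := fun m =>
  if h : (m : ℕ) < d then (if (m : ℕ) = 0 then x0 else 0)
  else y ⟨(m : ℕ) - d, by have := m.isLt; omega⟩

lemma scal_pos (N d : ℕ) (lam k : ℝ) (hl : 0 < lam) (hk : 0 < k) (m : Fin N) :
    0 < scal N d lam k m := by
  unfold scal; split_ifs <;> assumption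

lemma norm_scal_le (N d : ℕ) (lam k : ℝ) (hk : 0 < k) (hkl : k ≤ lam) (h : Fin N → ℝ) :
    ‖(fun m => scal N d lam k m * h m)‖ ≤ lam * ‖h‖ := by
  have hl : 0 < lam := hk.trans_le hkl
  rw [pi_norm_le_iff_of_nonneg (by positivity)]
  intro m
  rw [norm_mul, Real.norm_of_nonneg (scal_pos N d lam k hl hk m).le]
  have h1 : scal N d lam k m ≤ lam := by unfold scal; split_ifs <;> linarith
  exact mul_le_mul h1 (norm_le_pi_norm h m) (norm_nonneg _) hl.le

lemma volume_box (N d : ℕ) (hdN : d < N) (lam k : ℝ) (hl : 0 < lam) (hk : 0 < k) (c : Fin N → ℝ) :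
    volume (Set.univ.pi fun m => Set.Ioo (c m - 2 / scal N d lam k m) (c m + 2 / scal N d lam k m)) =
      ENNReal.ofReal (4 ^ N * lam⁻¹ ^ d * k⁻¹ ^ (N - d)) := by
  rw [Real.volume_pi_Ioo, ← ENNReal.ofReal_prod_of_nonneg]
  · congr 1
    have : ∀ m : Fin N, c m + 2 / scal N d lam k m - (c m - 2 / scal N d lam k m) =
        4 * (if (m : ℕ) < d then lam⁻¹ else k⁻¹) := by
      intro m
      unfold scal
      split_ifs <;> ring
    simp_rw [this]
    rw [Finset.prod_mul_distrib, Finset.prod_ite, Finset.prod_const, Finset.prod_const,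
      Finset.prod_const, Fin.card_filter_val_lt, Finset.filter_not, Finset.card_sdiff_of_subset
      (Finset.filter_subset _ _), Fin.card_filter_val_lt, Finset.card_univ, Fintype.card_fin,
      min_eq_right hdN.le]
    ring
  · intro m _
    have := scal_pos N d lam k hl hk m
    have : 0 < 2 / scal N d lam k m := by positivity
    linarith

lemma piece_real (N d M : ℕ) (lam k a C μ s P : ℝ) (hl : 0 < lam) (hk : 0 < k) (ha : 0 < a)
    (hC : 0 ≤ C) (hμ : 0 ≤ μ) (hP : 0 < P) :
    4 ^ N * lam⁻¹ ^ d * k⁻¹ ^ (N - d) * (a * lam ^ (-s + d / P) * (C * μ ^ M)) ^ P =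
      4 ^ N * C ^ P * (a ^ P * k⁻¹ ^ (N - d)) * (lam ^ (-(s * P)) * μ ^ (M * P)) := by
  rw [Real.mul_rpow (by positivity) (by positivity), Real.mul_rpow (by positivity) (by positivity),
    Real.mul_rpow (by positivity) (by positivity), ← Real.rpow_mul hl.le, ← Real.rpow_natCast μ M,
    ← Real.rpow_mul hμ]
  have h1 : (-s + d / P) * P = -(s * P) + d := by field_simp
  rw [h1, Real.rpow_add hl, Real.rpow_natCast, inv_pow lam]
  field_simp

section piece
variable {N d M : ℕ} {Φ : (Fin N → ℝ) → ℝ} {C : ℝ}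

lemma piece_support (hsupp : ∀ x, Φ x ≠ 0 → ‖x‖ < 2) (lam k A : ℝ) (hl : 0 < lam)
    (hk : 0 < k) (c x : Fin N → ℝ)
    (hx : A * Φ (fun m => scal N d lam k m * (x m - c m)) ≠ 0) :
    x ∈ Set.univ.pi fun m => Set.Ioo (c m - 2 / scal N d lam k m) (c m + 2 / scal N d lam k m) := by
  have h1 := hsupp _ (right_ne_zero_of_mul hx)
  rw [pi_norm_lt_iff (by norm_num)] at h1
  intro m _
  have h2 := h1 m
  have hp := scal_pos N d lam k hl hk m
  rw [Real.norm_eq_abs, abs_mul, abs_of_pos hp, mul_comm, ← lt_div_iff₀ hp, abs_lt] at h2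
  exact ⟨by linarith [h2.1], by linarith [h2.2]⟩

lemma piece_diff (hdN : d < N) (hC : 0 < C) (hsupp : ∀ x, Φ x ≠ 0 → ‖x‖ < 2)
    (hΦ : ∀ h x, |iterDiff M Φ h x| ≤ C * min 1 ‖h‖ ^ M)
    (lam k a s P : ℝ) (hk : 0 < k) (hkl : k ≤ lam) (ha : 0 < a) (hP : 0 < P)
    (c h : Fin N → ℝ) :
    ∫⁻ x, ‖iterDiff M (fun x => a * lam ^ (-s + d / P) *
        Φ (fun m => scal N d lam k m * (x m - c m))) h x‖ₑ ^ P ≤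
      (M + 1 : ℕ) * ENNReal.ofReal (4 ^ N * C ^ P * (a ^ P * k⁻¹ ^ (N - d)) *
        (lam ^ (-(s * P)) * min 1 (lam * ‖h‖) ^ (M * P))) := by
  have hl : 0 < lam := hk.trans_le hkl
  have hmin : 0 ≤ min 1 (lam * ‖h‖) := le_min zero_le_one (by positivity)
  refine (lintegral_le_of_support M _ (Set.univ.pi fun m =>
    Set.Ioo (c m - 2 / scal N d lam k m) (c m + 2 / scal N d lam k m))
    (MeasurableSet.univ_pi fun m => measurableSet_Ioo) h
    (a * lam ^ (-s + d / P) * (C * min 1 (lam * ‖h‖) ^ M)) P hP ?_ ?_).trans (le_of_eq ?_)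
  · intro x
    rw [iterDiff_affine, abs_mul, abs_of_pos (by positivity)]
    gcongr
    refine (hΦ _ _).trans ?_
    have hn := norm_scal_le N d lam k hk hkl h
    have h2 : 0 ≤ min 1 ‖(fun m => scal N d lam k m * h m)‖ := le_min zero_le_one (norm_nonneg _)
    gcongr
  · intro x hx
    by_contra! hcon
    apply hx
    unfold iterDiff
    refine Finset.sum_eq_zero fun i hi => ?_
    have : (a * lam ^ (-s + d / P) *
        Φ (fun m => scal N d lam k m * ((x + (i:ℝ) • h) m - c m))) = 0 := by
      by_contra h0
      exact hcon i hi (piece_support hsupp lam k _ hl hk c _ h0)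
    simp only [this, mul_zero]
  · rw [volume_box N d hdN lam k hl hk, mul_assoc, ← ENNReal.ofReal_mul (by positivity),
      piece_real N d M lam k a C _ s P hl hk ha hC.le hmin hP]

lemma piece_self (hdN : d < N) (hsupp : ∀ x, Φ x ≠ 0 → ‖x‖ < 2)
    (h0 : ∀ x, 0 ≤ Φ x) (h1 : ∀ x, Φ x ≤ 1)
    (lam k a s P : ℝ) (hk : 0 < k) (hkl : k ≤ lam) (ha : 0 < a) (hP : 0 < P)
    (c : Fin N → ℝ) :
    ∫⁻ x : Fin N → ℝ, ‖a * lam ^ (-s + d / P) * Φ (fun m => scal N d lam k m * (x m - c m))‖ₑ ^ P ≤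
      ENNReal.ofReal (4 ^ N * (a ^ P * k⁻¹ ^ (N - d)) * lam ^ (-(s * P))) := by
  have hl : 0 < lam := hk.trans_le hkl
  refine (lintegral_le_of_support 0 _ (Set.univ.pi fun m =>
    Set.Ioo (c m - 2 / scal N d lam k m) (c m + 2 / scal N d lam k m))
    (MeasurableSet.univ_pi fun m => measurableSet_Ioo) 0
    (a * lam ^ (-s + d / P) * (1 * 1 ^ 0)) P hP ?_ ?_).trans (le_of_eq ?_)
  · intro x
    rw [abs_mul, abs_of_pos (by positivity), abs_of_nonneg (h0 _)]
    gcongr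
    simpa using h1 _
  · intro x hx
    exact ⟨0, by simp, by simpa using piece_support hsupp lam k _ hl hk c x hx⟩
  · rw [volume_box N d hdN lam k hl hk, mul_assoc, ← ENNReal.ofReal_mul (by positivity),
      piece_real N d 0 lam k a 1 1 s P hl hk ha zero_le_one zero_le_one hP]
    simp

end piece

section glue

noncomputable def glue {ι E : Type*} (g : ι → E → ℝ) : E → ℝ := fun x => (∑' i, ENNReal.ofReal (g i x)).toReal

lemma glue_eval {ι E : Type*} (g : ι → E → ℝ) (h0 : ∀ i x, 0 ≤ g i x) (k : ι) (x : E)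
    (hk : ∀ l, l ≠ k → g l x = 0) : glue g x = g k x := by
  unfold glue
  rw [tsum_eq_single k (fun l hl => by simp [hk l hl]), ENNReal.toReal_ofReal (h0 k x)]

lemma glue_diff {ι E : Type*} [NormedAddCommGroup E] [NormedSpace ℝ E] [Nonempty ι] (M : ℕ) (g : ι → E → ℝ) (h0 : ∀ i x, 0 ≤ g i x)
    (hsep : ∀ k l x x', g k x ≠ 0 → g l x' ≠ 0 → ‖x - x'‖ ≤ M → k = l) (h : E) (hh : ‖h‖ ≤ 1)
    (x : E) : ∃ k, iterDiff M (glue g) h x = iterDiff M (g k) h x := by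
  have hex : ∃ k, ∀ i ∈ Finset.range (M + 1), ∀ l, l ≠ k → g l (x + (i : ℝ) • h) = 0 := by
    by_cases hc : ∃ k, ∃ i ∈ Finset.range (M + 1), g k (x + (i : ℝ) • h) ≠ 0
    · obtain ⟨k, i, hi, hki⟩ := hc
      refine ⟨k, fun i' hi' l hl => ?_⟩
      by_contra hli
      refine hl (hsep l k _ _ hli hki ?_)
      have : x + (i' : ℝ) • h - (x + (i : ℝ) • h) = ((i' : ℝ) - i) • h := by
        rw [sub_smul]; abel
      rw [this, norm_smul]
      have hii : ‖(i' : ℝ) - i‖ ≤ M := by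
        rw [Real.norm_eq_abs, abs_le]
        have h1 : (i : ℝ) ≤ M := by exact_mod_cast Finset.mem_range_succ_iff.1 hi
        have h2 : (i' : ℝ) ≤ M := by exact_mod_cast Finset.mem_range_succ_iff.1 hi'
        have h3 : (0:ℝ) ≤ i := Nat.cast_nonneg _
        have h4 : (0:ℝ) ≤ i' := Nat.cast_nonneg _
        constructor <;> linarith
      calc _ ≤ (M : ℝ) * 1 := by gcongr
        _ = M := mul_one _
    · push Not at hc
      exact ⟨Classical.arbitrary ι, fun i hi l _ => hc l i hi⟩
  obtain ⟨k, hk⟩ := hex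
  refine ⟨k, ?_⟩
  unfold iterDiff
  refine Finset.sum_congr rfl fun i hi => ?_
  rw [glue_eval g h0 k _ (hk i hi)]

end glue

lemma upper_bound (N : ℕ) (hN : 1 ≤ N) (p q : ℝ≥0∞) (hp : 0 < p) (hpt : p ≠ ⊤)
    (s r : ℝ) (hs : 0 < s) (hr : 1 < r) (hrq : q ≠ ⊤ → q.toReal = p.toReal * r)
    {ι : Type} [Nonempty ι] (j : ι → ℕ) (hj : Function.Injective j) (c : ι → ℝ)
    (hc0 : ∀ i, 0 ≤ c i)
    (hc : ∑' i, ENNReal.ofReal (c i) ^ r < ⊤) (g : ι → (Fin N → ℝ) → ℝ)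
    (hgc : ∀ i, Continuous (g i)) (g0 : ∀ i x, 0 ≤ g i x) (D : ℝ) (hD : 0 < D)
    (hsep : ∀ k l x x', g k x ≠ 0 → g l x' ≠ 0 → ‖x - x'‖ ≤ (⌊s⌋₊ + 1 : ℕ) → k = l)
    (hself : ∀ i, ∫⁻ x, ‖g i x‖ₑ ^ p.toReal ≤
      ENNReal.ofReal (D * c i * (2 ^ j i : ℝ) ^ (-(s * p.toReal))))
    (hdiff : ∀ i h, ∫⁻ x, ‖iterDiff (⌊s⌋₊ + 1) (g i) h x‖ₑ ^ p.toReal ≤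
      ENNReal.ofReal (D * c i * ((2 ^ j i : ℝ) ^ (-(s * p.toReal)) *
        min 1 (2 ^ j i * ‖h‖) ^ ((⌊s⌋₊ + 1 : ℕ) * p.toReal)))) :
    MemBesov N p q s (glue g) := by
  set P := p.toReal with hPdef
  have hP : 0 < P := ENNReal.toReal_pos hp.ne' hpt
  set M := ⌊s⌋₊ + 1 with hM
  have hsM : s < (M : ℝ) := by rw [hM]; exact_mod_cast Nat.lt_floor_add_one s
  have hcount : Countable ι := hj.countable
  obtain ⟨u, K, hu0, hu1, hK0, hker⟩ := kernel_bound (s * P) (M * P) (by positivity)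
    (by gcongr)
  set S : ℕ → ℝ≥0∞ := fun J => ∑' i, ENNReal.ofReal (c i) *
    (ENNReal.ofReal u ^ ((j i : ℤ) - J).natAbs * ENNReal.ofReal u ^ ((j i : ℤ) - J).natAbs) with hS
  obtain ⟨⟨B, hBt, hB⟩, hSr⟩ := discrete_young j hj (fun i => ENNReal.ofReal (c i))
    (ENNReal.ofReal u) (by simpa using hu1) r hr hc S (fun J => rfl)
  -- kernel in ENNReal form
  have hker' : ∀ (i : ι) (J : ℕ) (t : ℝ), (1 / 2 : ℝ) ^ (J + 1) < t → t ≤ (1 / 2) ^ J →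
      ENNReal.ofReal (D * c i * ((2 ^ j i : ℝ) ^ (-(s * P)) * min 1 (2 ^ j i * t) ^ (M * P))) *
        ENNReal.ofReal (t ^ (-(s * P))) ≤ ENNReal.ofReal (D * K) * (ENNReal.ofReal (c i) *
    (ENNReal.ofReal u ^ ((j i : ℤ) - J).natAbs * ENNReal.ofReal u ^ ((j i : ℤ) - J).natAbs)) := by
    intro i J t h1 h2
    have ht : 0 < t := lt_trans (by positivity) h1
    have hmin : 0 ≤ min 1 (2 ^ j i * t) := le_min zero_le_one (by positivity)
    have hci := hc0 i
    rw [← ENNReal.ofReal_mul (by positivity), ← ENNReal.ofReal_pow hu0.le,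
      ← ENNReal.ofReal_mul (by positivity), ← ENNReal.ofReal_mul (by positivity),
      ← ENNReal.ofReal_mul (by positivity)]
    apply ENNReal.ofReal_le_ofReal
    have h3 := hker (j i) J t h1 h2
    rw [Real.mul_rpow (by positivity) ht.le] at h3
    calc _ = (D * c i) * ((2 ^ j i : ℝ) ^ (-(s * P)) * t ^ (-(s * P)) *
          min 1 (2 ^ j i * t) ^ (M * P)) := by ring
      _ ≤ (D * c i) * (K * (u ^ ((j i : ℤ) - J).natAbs * u ^ ((j i : ℤ) - J).natAbs)) :=
          mul_le_mul_of_nonneg_left h3 (by positivity)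
      _ = _ := by ring
  -- measurability
  have hmeas : Measurable (glue g) := by
    unfold glue
    exact (Measurable.ennreal_tsum fun i => (hgc i).measurable.ennreal_ofReal).ennreal_toReal
  -- bound for f
  have hf : ∫⁻ x, ‖glue g x‖ₑ ^ P ≤ ENNReal.ofReal (D * K) * S 0 := by
    have hpt : ∀ x, ‖glue g x‖ₑ ^ P ≤ ∑' i, ‖g i x‖ₑ ^ P := by
      intro x
      have : ∃ k, ∀ l, l ≠ k → g l x = 0 := by
        by_cases hcx : ∃ k, g k x ≠ 0
        · obtain ⟨k, hk⟩ := hcx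
          refine ⟨k, fun l hl => ?_⟩
          by_contra h
          exact hl (hsep l k x x h hk (by simp only [sub_self, norm_zero]; positivity))
        · push Not at hcx
          exact ⟨Classical.arbitrary ι, fun l _ => hcx l⟩
      obtain ⟨k, hk⟩ := this
      rw [glue_eval g g0 k x hk]
      exact ENNReal.le_tsum (f := fun i => ‖g i x‖ₑ ^ P) k
    calc _ ≤ ∫⁻ x, ∑' i, ‖g i x‖ₑ ^ P := lintegral_mono hpt
      _ = ∑' i, ∫⁻ x, ‖g i x‖ₑ ^ P := lintegral_tsum fun i =>
          ((hgc i).measurable.enorm.pow_const P).aemeasurable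
      _ ≤ ∑' i, ENNReal.ofReal (D * K) * (ENNReal.ofReal (c i) *
          (ENNReal.ofReal u ^ ((j i : ℤ) - (0:ℕ)).natAbs *
            ENNReal.ofReal u ^ ((j i : ℤ) - (0:ℕ)).natAbs)) := by
          refine ENNReal.tsum_le_tsum fun i => (hself i).trans ?_
          refine le_trans (le_of_eq ?_) (hker' i 0 1 (by norm_num) (by norm_num))
          have : min 1 (2 ^ j i * 1 : ℝ) = 1 := by
            rw [mul_one]; exact min_eq_left (one_le_pow₀ (by norm_num))
          rw [this]
          simp
      _ = _ := by rw [ENNReal.tsum_mul_left]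
  -- bound for differences
  have hdf : ∀ (J : ℕ) (h : Fin N → ℝ), (1 / 2 : ℝ) ^ (J + 1) < ‖h‖ → ‖h‖ ≤ (1 / 2) ^ J →
      (∫⁻ x, ‖iterDiff M (glue g) h x‖ₑ ^ P) * ENNReal.ofReal (‖h‖ ^ (-(s * P))) ≤
        ENNReal.ofReal (D * K) * S J := by
    intro J h h1 h2
    have hh : ‖h‖ ≤ 1 := h2.trans (pow_le_one₀ (by norm_num) (by norm_num))
    have hpt : ∀ x, ‖iterDiff M (glue g) h x‖ₑ ^ P ≤ ∑' i, ‖iterDiff M (g i) h x‖ₑ ^ P := by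
      intro x
      obtain ⟨k, hk⟩ := glue_diff M g g0 hsep h hh x
      rw [hk]
      exact ENNReal.le_tsum (f := fun i => ‖iterDiff M (g i) h x‖ₑ ^ P) k
    have hcd : ∀ i, Continuous (iterDiff M (g i) h) := by
      intro i
      unfold iterDiff
      have := hgc i
      fun_prop
    calc _ ≤ (∫⁻ x, ∑' i, ‖iterDiff M (g i) h x‖ₑ ^ P) * ENNReal.ofReal (‖h‖ ^ (-(s * P))) := by
          gcongr with x
          exact hpt x
      _ = ∑' i, (∫⁻ x, ‖iterDiff M (g i) h x‖ₑ ^ P) * ENNReal.ofReal (‖h‖ ^ (-(s * P))) := by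
          rw [lintegral_tsum fun i => ((hcd i).measurable.enorm.pow_const P).aemeasurable,
            ENNReal.tsum_mul_right]
      _ ≤ ∑' i, ENNReal.ofReal (D * K) * (ENNReal.ofReal (c i) *
          (ENNReal.ofReal u ^ ((j i : ℤ) - J).natAbs *
            ENNReal.ofReal u ^ ((j i : ℤ) - J).natAbs)) := by
          refine ENNReal.tsum_le_tsum fun i => ?_
          exact (mul_le_mul' (hdiff i h) le_rfl).trans (hker' i J ‖h‖ h1 h2)
      _ = _ := by rw [ENNReal.tsum_mul_left]
  have hDK : ENNReal.ofReal (D * K) < ⊤ := ENNReal.ofReal_lt_top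
  have hSB : ∀ J, ENNReal.ofReal (D * K) * S J ≤ ENNReal.ofReal (D * K) * B := fun J =>
    mul_le_mul' le_rfl (hB J)
  have hDB : ENNReal.ofReal (D * K) * B < ⊤ := ENNReal.mul_lt_top hDK hBt
  refine ⟨hmeas.aestronglyMeasurable, ?_⟩
  unfold besovNorm
  refine ENNReal.add_lt_top.2 ⟨?_, ?_⟩
  · rw [eLpNorm_eq_lintegral_rpow_enorm_toReal hp.ne' hpt]
    exact ENNReal.rpow_lt_top_of_nonneg (by positivity) ((hf.trans (hSB 0)).trans_lt hDB).ne
  · split_ifs with hq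
    · refine lt_of_le_of_lt (b := (ENNReal.ofReal (D * K) * B) ^ (1 / P)) ?_
        (ENNReal.rpow_lt_top_of_nonneg (by positivity) hDB.ne)
      refine iSup₂_le fun h hh => ?_
      by_cases h0 : h = 0
      · have : (0:ℝ) ^ (-s) = 0 := Real.zero_rpow (by linarith)
        simp [h0, this]
      · have hh0 := norm_pos_iff.2 h0
        obtain ⟨J, h1, h2⟩ := exists_nat_pow_near_of_lt_one hh0 hh
          (by norm_num : (0:ℝ) < 1 / 2) (by norm_num)
        have e : ENNReal.ofReal (‖h‖ ^ (-s)) = ENNReal.ofReal (‖h‖ ^ (-(s * P))) ^ (1 / P) := by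
          rw [ENNReal.ofReal_rpow_of_nonneg (by positivity) (by positivity),
            ← Real.rpow_mul hh0.le]
          congr 2
          field_simp
        rw [eLpNorm_eq_lintegral_rpow_enorm_toReal hp.ne' hpt, e,
          ← ENNReal.mul_rpow_of_nonneg _ _ (by positivity)]
        exact ENNReal.rpow_le_rpow ((hdf J h h1 h2).trans (hSB J)) (by positivity)
    · apply ENNReal.rpow_lt_top_of_nonneg (by positivity)
      have hqP := hrq hq
      refine (lt_of_le_of_lt (shell_integral N hN _ (fun J => (ENNReal.ofReal (D * K) * S J) ^ r)
        ?_) ?_).ne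
      · intro J h h1 h2
        have hh0 : 0 < ‖h‖ := lt_trans (by positivity) h1
        have e : ENNReal.ofReal (‖h‖ ^ (-(N : ℝ) - s * q.toReal)) =
            ENNReal.ofReal (‖h‖ ^ (-(s * P))) ^ r * ENNReal.ofReal (‖h‖ ^ (-(N : ℝ))) := by
          rw [ENNReal.ofReal_rpow_of_nonneg (by positivity) (by positivity),
            ← Real.rpow_mul hh0.le, ← ENNReal.ofReal_mul (by positivity), ← Real.rpow_add hh0, hqP]
          congr 2
          ring
        rw [eLpNorm_eq_lintegral_rpow_enorm_toReal hp.ne' hpt, e, ← ENNReal.rpow_mul, hqP]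
        have e2 : 1 / p.toReal * (P * r) = r := by rw [← hPdef]; field_simp
        rw [e2, ← mul_assoc, ← ENNReal.mul_rpow_of_nonneg _ _ (by positivity)]
        exact mul_le_mul' (ENNReal.rpow_le_rpow (hdf J h h1 h2) (by positivity)) le_rfl
      · simp_rw [ENNReal.mul_rpow_of_nonneg _ _ (show (0:ℝ) ≤ r by positivity)]
        rw [ENNReal.tsum_mul_left]
        refine ENNReal.mul_lt_top (ENNReal.pow_lt_top (by norm_num)) (ENNReal.mul_lt_top ?_ hSr)
        exact ENNReal.rpow_lt_top_of_nonneg (by positivity) hDK.ne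

lemma lower_bound (d : ℕ) (hd : 1 ≤ d) (p : ℝ≥0∞) (hp : 0 < p) (hpt : p ≠ ⊤) (s lam a : ℝ)
    (hlam : 4 ≤ lam) (ha : 0 < a) (F : (Fin d → ℝ) → ℝ) (x0 : Fin d → ℝ)
    (hF1 : ∀ x, (∀ m, |lam * (x m - x0 m)| ≤ 1) → F x = a * lam ^ (-s + d / p.toReal))
    (hF0 : ∀ x, (∀ m, |lam * (x m - x0 m)| ≤ 1) → ∀ i : ℕ, 1 ≤ i → i ≤ ⌊s⌋₊ + 1 →
      F (x + (i : ℝ) • Pi.single ⟨0, hd⟩ (4 / lam)) = 0) :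
    ENNReal.ofReal (a * 4 ^ (-s)) ≤ besovNorm d p ⊤ s F := by
  set P := p.toReal with hPdef
  have hP : 0 < P := ENNReal.toReal_pos hp.ne' hpt
  have hl : 0 < lam := by linarith
  set h : Fin d → ℝ := Pi.single ⟨0, hd⟩ (4 / lam) with hh
  have hn : ‖h‖ = 4 / lam := by
    rw [hh, Pi.norm_single, Real.norm_of_nonneg (by positivity)]
  have hn1 : ‖h‖ ≤ 1 := by rw [hn, div_le_one hl]; exact hlam
  set Q : Set (Fin d → ℝ) := Set.Icc (fun m => x0 m - 1 / lam) (fun m => x0 m + 1 / lam) with hQ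
  have hmem : ∀ x ∈ Q, ∀ m, |lam * (x m - x0 m)| ≤ 1 := by
    intro x hx m
    rw [abs_mul, abs_of_pos hl, mul_comm, ← le_div_iff₀ hl, abs_le]
    have h1 := hx.1 m
    have h2 := hx.2 m
    simp only at h1 h2
    constructor <;> linarith
  set A := a * lam ^ (-s + d / P) with hA
  have hA0 : 0 < A := by positivity
  have hval : ∀ x ∈ Q, |iterDiff (⌊s⌋₊ + 1) F h x| = A := by
    intro x hx
    unfold iterDiff
    rw [Finset.sum_eq_single 0]
    · simp [hF1 x (hmem x hx), abs_mul, abs_of_pos hA0]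
    · intro i hi hi0
      rw [hF0 x (hmem x hx) i (Nat.one_le_iff_ne_zero.2 hi0) (Finset.mem_range_succ_iff.1 hi),
        mul_zero]
    · simp
  have hvol : volume Q = ENNReal.ofReal ((2 / lam) ^ d) := by
    rw [hQ, Real.volume_Icc_pi]
    have : ∀ m : Fin d, x0 m + 1 / lam - (x0 m - 1 / lam) = 2 / lam := fun m => by ring
    simp_rw [this]
    rw [Finset.prod_const, Finset.card_univ, Fintype.card_fin, ENNReal.ofReal_pow (by positivity)]
  have hlow : ENNReal.ofReal A * ENNReal.ofReal ((2 / lam) ^ d) ^ (1 / P) ≤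
      eLpNorm (iterDiff (⌊s⌋₊ + 1) F h) p volume := by
    have := eLpNorm_indicator_const (μ := (volume : Measure (Fin d → ℝ))) (c := A) (s := Q)
      measurableSet_Icc hp.ne' hpt
    rw [hvol, Real.enorm_eq_ofReal_abs, abs_of_pos hA0] at this
    rw [← this]
    refine eLpNorm_mono fun x => ?_
    by_cases hx : x ∈ Q
    · rw [Set.indicator_of_mem hx, Real.norm_eq_abs, Real.norm_eq_abs, hval x hx, abs_of_pos hA0]
    · rw [Set.indicator_of_notMem hx, norm_zero]
      exact norm_nonneg _
  unfold besovNorm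
  rw [if_pos rfl]
  refine le_trans ?_ le_add_self
  refine le_trans ?_ (le_iSup₂ (f := fun (h : Fin d → ℝ) (_ : ‖h‖ ≤ 1) =>
    eLpNorm (iterDiff (⌊s⌋₊ + 1) F h) p volume * ENNReal.ofReal (‖h‖ ^ (-s))) h hn1)
  refine le_trans ?_ (mul_le_mul' hlow le_rfl)
  rw [hn, ENNReal.ofReal_rpow_of_nonneg (by positivity) (by positivity),
    ← ENNReal.ofReal_mul hA0.le, ← ENNReal.ofReal_mul (by positivity)]
  apply ENNReal.ofReal_le_ofReal
  have e1 : ((2 / lam) ^ d : ℝ) ^ (1 / P) = 2 ^ (d / P) * lam ^ (-(d / P)) := by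
    rw [← Real.rpow_natCast, ← Real.rpow_mul (by positivity), Real.div_rpow (by norm_num) hl.le,
      Real.rpow_neg hl.le, mul_one_div, div_eq_mul_inv]
  have e2 : (4 / lam : ℝ) ^ (-s) = 4 ^ (-s) * lam ^ s := by
    rw [Real.div_rpow (by norm_num) hl.le, Real.rpow_neg hl.le, div_inv_eq_mul]
  have e3 : lam ^ (-s + d / P) * lam ^ (-(d / P)) * lam ^ s = 1 := by
    rw [← Real.rpow_add hl, ← Real.rpow_add hl]
    have : -s + d / P + -(d / P) + s = 0 := by ring
    rw [this, Real.rpow_zero]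
  have e4 : (1:ℝ) ≤ 2 ^ (d / P) := Real.one_le_rpow (by norm_num) (by positivity)
  rw [hA, e1, e2]
  calc a * 4 ^ (-s) ≤ a * 4 ^ (-s) * 2 ^ (d / P) := le_mul_of_one_le_right (by positivity) e4
    _ = a * 4 ^ (-s) * 2 ^ (d / P) * (lam ^ (-s + d / P) * lam ^ (-(d / P)) * lam ^ s) := by
        rw [e3, mul_one]
    _ = _ := by ring

end BesovAux

open BesovAux

/-- Theorem 1.3: for `0 < p < q ≤ ∞` and `s > σ_p` there exists `f ∈ B^s_{p,q}(ℝ^N)` whose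
restrictions satisfy `f(·,y) ∉ B^s_{p,∞}(ℝ^d)` for almost every `y ∈ ℝ^{N-d}`. -/
theorem besov_restriction_fails_p_lt_q (N d : ℕ) (hN : 2 ≤ N) (hd : 1 ≤ d) (hdN : d < N)
    (p q : ℝ≥0∞) (hp : 0 < p) (hpq : p < q)
    (s : ℝ) (hs : sigmaP N p < s) :
    ∃ f : (Fin N → ℝ) → ℝ, MemBesov N p q s f ∧
      ∀ᵐ y ∂(MeasureTheory.volume : Measure (Fin (N - d) → ℝ)),
        ¬ MemBesov d p ⊤ s (restrictLast N d f y) := by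
  have hpt : p ≠ ⊤ := (hpq.trans_le le_top).ne
  have hP : 0 < p.toReal := ENNReal.toReal_pos hp.ne' hpt
  have hs0 : 0 < s := by
    refine lt_of_le_of_lt ?_ hs
    unfold sigmaP
    positivity
  obtain ⟨r, hr, hrq⟩ : ∃ r : ℝ, 1 < r ∧ (q ≠ ⊤ → q.toReal = p.toReal * r) := by
    by_cases hq : q = ⊤
    · exact ⟨2, by norm_num, fun h => absurd hq h⟩
    · refine ⟨q.toReal / p.toReal, ?_, fun _ => by field_simp⟩
      rw [one_lt_div hP]
      exact (ENNReal.toReal_lt_toReal hpt hq).2 hpq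
  obtain ⟨ι, j, a, k, y, hj, ha, hk1, hkj, hj4, hsum, hcov⟩ :=
    exists_params (N - d) (by omega) p.toReal r hr
  set M := ⌊s⌋₊ + 1 with hM
  obtain ⟨Φ, C, hΦc, hC, hΦ0, hΦ1, hΦone, hΦs, hΦd⟩ := exists_bump N M
  have hne : Nonempty ι := ⟨(hcov 0 0).choose⟩
  have hk0 : ∀ i, 0 < k i := fun i => by linarith [hk1 i]
  have hN0 : 0 < N := by omega
  set A : ι → ℝ := fun i => a i * (2 ^ j i : ℝ) ^ (-s + d / p.toReal) with hA
  have hA0 : ∀ i, 0 < A i := fun i => by have := ha i; positivity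
  set ct : ι → Fin N → ℝ := fun i => ctr N d ((M + 2 : ℝ) * j i) (y i) with hct
  have hct0 : ∀ i, ct i ⟨0, hN0⟩ = (M + 2 : ℝ) * j i := by
    intro i
    simp only [hct, ctr]
    rw [dif_pos (by omega)]
    simp
  set g : ι → (Fin N → ℝ) → ℝ := fun i x =>
    A i * Φ (fun m => scal N d (2 ^ j i) (k i) m * (x m - ct i m)) with hg
  have g0 : ∀ i x, 0 ≤ g i x := fun i x => mul_nonneg (hA0 i).le (hΦ0 _)
  have hgsupp : ∀ i x, g i x ≠ 0 → |x ⟨0, hN0⟩ - (M + 2 : ℝ) * j i| < 2 / 2 ^ j i := by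
    intro i x hx
    have h1 := piece_support hΦs (2 ^ j i) (k i) (A i) (by positivity) (hk0 i) (ct i) x hx
      ⟨0, hN0⟩ (Set.mem_univ _)
    have h2 : scal N d (2 ^ j i) (k i) ⟨0, hN0⟩ = 2 ^ j i := if_pos (by simp; omega)
    simp only [h2, hct0, Set.mem_Ioo] at h1
    rw [abs_lt]
    constructor <;> linarith [h1.1, h1.2]
  have hhalf : ∀ i, (2 : ℝ) / 2 ^ j i ≤ 1 / 2 := by
    intro i
    rw [div_le_div_iff₀ (by positivity) (by norm_num)]
    linarith [hj4 i]
  have hsep : ∀ k l x x', g k x ≠ 0 → g l x' ≠ 0 → ‖x - x'‖ ≤ M → k = l := by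
    intro k l x x' hx hx' hxx
    apply hj
    have h1 := abs_lt.1 ((hgsupp k x hx).trans_le (hhalf k))
    have h2 := abs_lt.1 ((hgsupp l x' hx').trans_le (hhalf l))
    have h3 := abs_le.1 ((norm_le_pi_norm (x - x') ⟨0, hN0⟩).trans hxx)
    simp only [Pi.sub_apply] at h3
    have hM0 : (0:ℝ) ≤ M := Nat.cast_nonneg M
    rcases lt_trichotomy (j k) (j l) with hlt | heq | hlt
    · exfalso
      have : (j k : ℝ) + 1 ≤ j l := by exact_mod_cast hlt
      have : (M + 2 : ℝ) * (j k + 1) ≤ (M + 2 : ℝ) * j l := by gcongr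
      linarith [h1.1, h1.2, h2.1, h2.2, h3.1, h3.2]
    · exact heq
    · exfalso
      have : (j l : ℝ) + 1 ≤ j k := by exact_mod_cast hlt
      have : (M + 2 : ℝ) * (j l + 1) ≤ (M + 2 : ℝ) * j k := by gcongr
      linarith [h1.1, h1.2, h2.1, h2.2, h3.1, h3.2]
  refine ⟨glue g, ?_, Filter.Eventually.of_forall fun w hw => ?_⟩
  · refine upper_bound N (by omega) p q hp hpt s r hs0 hr hrq j hj
      (fun i => a i ^ p.toReal * (k i)⁻¹ ^ (N - d)) ?_ hsum g ?_ g0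
      ((M + 1 : ℕ) * (4 ^ N * (C ^ p.toReal + 1))) (by positivity) hsep ?_ ?_
    · intro i
      have := ha i
      have := hk0 i
      positivity
    · intro i
      simp only [hg]
      fun_prop
    · intro i
      have hai := ha i
      have hki := hk0 i
      refine (piece_self hdN hΦs hΦ0 hΦ1 (2 ^ j i) (k i) (a i) s p.toReal (hk0 i) (hkj i) (ha i)
        hP (ct i)).trans (ENNReal.ofReal_le_ofReal ?_)
      gcongr
      have h1 : (0:ℝ) ≤ C ^ p.toReal := by positivity
      have h2 : (1:ℝ) ≤ (M + 1 : ℕ) := by exact_mod_cast Nat.le_add_left 1 M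
      calc (4:ℝ) ^ N = 1 * (4 ^ N * 1) := by ring
        _ ≤ _ := by gcongr; linarith
    · intro i h
      have hai := ha i
      have hki := hk0 i
      have hmin : 0 ≤ min 1 (2 ^ j i * ‖h‖) := le_min zero_le_one (by positivity)
      refine (piece_diff hdN hC hΦs hΦd (2 ^ j i) (k i) (a i) s p.toReal (hk0 i) (hkj i) (ha i)
        hP (ct i) h).trans ?_
      rw [← ENNReal.ofReal_natCast, ← ENNReal.ofReal_mul (by positivity)]
      apply ENNReal.ofReal_le_ofReal
      have hle : (4:ℝ) ^ N * C ^ p.toReal ≤ 4 ^ N * (C ^ p.toReal + 1) := by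
        gcongr
        linarith
      rw [← mul_assoc, ← mul_assoc ((M + 1 : ℕ) : ℝ)]
      refine mul_le_mul_of_nonneg_right (mul_le_mul_of_nonneg_right
        (mul_le_mul_of_nonneg_left hle ?_) ?_) ?_ <;> positivity
  · have hlow : ∀ L : ℝ, ENNReal.ofReal (L * 4 ^ (-s)) ≤
        besovNorm d p ⊤ s (restrictLast N d (glue g) w) := by
      intro L
      obtain ⟨i, hLi, hi⟩ := hcov w L
      refine le_trans (ENNReal.ofReal_le_ofReal (mul_le_mul_of_nonneg_right hLi (by positivity)))
        (lower_bound d hd p hp hpt s (2 ^ j i) (a i) (hj4 i) (ha i) _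
          (fun m => if (m : ℕ) = 0 then (M + 2 : ℝ) * j i else 0) ?_ ?_)
      all_goals
        intro x hx
        set X : (Fin d → ℝ) → Fin N → ℝ := fun x i =>
          if h : (i : ℕ) < d then x ⟨i, h⟩ else w ⟨(i : ℕ) - d, by have := i.isLt; omega⟩ with hX
        have hres : ∀ x, restrictLast N d (glue g) w x = glue g (X x) := fun x => rfl
        have hgi : g i (X x) = A i := by
          simp only [hg]
          rw [hΦone, mul_one]
          rw [pi_norm_le_iff_of_nonneg zero_le_one]
          intro m
          rw [Real.norm_eq_abs]
          by_cases hm : (m : ℕ) < d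
          · have := hx ⟨m, hm⟩
            simpa [hX, hct, ctr, scal, hm] using this
          · have := hi ⟨(m : ℕ) - d, by have := m.isLt; omega⟩
            simpa [hX, hct, ctr, scal, hm] using this
        have hgi0 : g i (X x) ≠ 0 := by rw [hgi]; exact (hA0 i).ne'
        have hMn : (0:ℝ) ≤ M := Nat.cast_nonneg M
      · rw [hres, glue_eval g g0 i]
        · exact hgi
        · intro l hl
          by_contra h
          exact hl (hsep l i _ _ h hgi0 (by simpa using hMn))
      · intro b hb1 hbM
        have hd0 : 0 < d := hd
        have hb1' : (1:ℝ) ≤ b := by exact_mod_cast hb1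
        have hbM' : (b:ℝ) ≤ M := by exact_mod_cast hbM
        have hlp : (0:ℝ) < 2 ^ j i := by positivity
        set x' : Fin d → ℝ := x + (b : ℝ) • Pi.single ⟨0, hd⟩ (4 / 2 ^ j i) with hx'
        have hall : ∀ l, g l (X x') = 0 := by
          intro l
          by_contra hne0
          have hli : l = i := by
            refine hsep l i _ _ hne0 hgi0 ?_
            rw [pi_norm_le_iff_of_nonneg hMn]
            intro m
            by_cases hm : (m : ℕ) < d
            · have e : (X x' - X x) m = b * (Pi.single (⟨0, hd⟩ : Fin d) (4 / 2 ^ j i : ℝ) : Fin d → ℝ) ⟨m, hm⟩ := by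
                simp [hX, hm, hx']
              rw [e, norm_mul, Real.norm_of_nonneg (by linarith)]
              have h4 : ‖(Pi.single (⟨0, hd⟩ : Fin d) (4 / 2 ^ j i : ℝ) : Fin d → ℝ) ⟨m, hm⟩‖ ≤ 1 := by
                refine (norm_le_pi_norm _ _).trans ?_
                rw [Pi.norm_single, Real.norm_of_nonneg (by positivity), div_le_one hlp]
                exact hj4 i
              calc _ ≤ (M:ℝ) * 1 := by gcongr
                _ = M := mul_one _
            · simpa [hX, hm] using hMn
          subst hli
          have h5 := (abs_lt.1 (hgsupp l _ hne0)).2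
          have h6 := hx ⟨0, hd⟩
          have e : X x' ⟨0, hN0⟩ = x ⟨0, hd⟩ + b * (4 / 2 ^ j l) := by
            simp [hX, hd0, hx']
          rw [e] at h5
          simp only [if_true] at h6
          rw [abs_mul, abs_of_pos hlp, mul_comm, ← le_div_iff₀ hlp, abs_le] at h6
          have h7 : (4 / 2 ^ j l : ℝ) ≤ b * (4 / 2 ^ j l) :=
            le_mul_of_one_le_left (by positivity) hb1'
          have h8 : (4 / 2 ^ j l : ℝ) = 4 * (1 / 2 ^ j l) := by ring
          have h9 : (2 / 2 ^ j l : ℝ) = 2 * (1 / 2 ^ j l) := by ring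
          have h10 : (0:ℝ) < 1 / 2 ^ j l := by positivity
          linarith [h6.1]
        rw [hres, glue_eval g g0 i _ (fun l _ => hall l), hall]
    have hlt := hw.2
    set Z := besovNorm d p ⊤ s (restrictLast N d (glue g) w) with hZ
    have h4 : (0:ℝ) < 4 ^ (-s) := by positivity
    have h1 := hlow ((Z.toReal + 1) / 4 ^ (-s))
    rw [div_mul_cancel₀ _ h4.ne', ENNReal.ofReal_le_iff_le_toReal hlt.ne] at h1
    linarith
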